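/- Pessimism of the bonus-adjusted value function: let ℙ and ℙ̂ be two transition kernels of the same layered MDP, let B(s,a,s') ≥ 0 satisfy |ℙ̂[s'|s,a] − ℙ[s'|s,a]| ≤ B(s,a,s') for all s ∈ 𝒮_h, a ∈ 𝒜, s' ∈ 𝒮_{h+1}, and let ℓ̄ : 𝒮×𝒜 → ℝ satisfy |ℓ̄(s,a)| ≤ σ for all (s,a), with σ > 0. Set D = Hσ and ℓ̄^{pess}(s,a) = ℓ̄(s,a) − D · ∑_{s'∈𝒮_{h+1}} B(s,a,s'). Then for every policy π and every state s, V^{ℙ̂, π}(s; ℓ̄^{pess}) ≤ V^{ℙ, π}(s; ℓ̄). -/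

import Mathlib

open Finset MeasureTheory

open scoped Classical

theorem abs_sum_mul_le_of_sum_le_one {ι : Type*} [Fintype ι] {w f : ι → ℝ} {c : ℝ}
    (hw : ∀ i, 0 ≤ w i) (hsum : ∑ i, w i ≤ 1) (hc : 0 ≤ c) (hf : ∀ i, w i ≠ 0 → |f i| ≤ c) :
    |∑ i, w i * f i| ≤ c := by
  calc |∑ i, w i * f i| ≤ ∑ i, |w i * f i| := Finset.abs_sum_le_sum_abs _ _
    _ ≤ ∑ i, w i * c := by
        refine Finset.sum_le_sum fun i _ => ?_
        rw [abs_mul, abs_of_nonneg (hw i)]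
        by_cases h : w i = 0
        · simp [h]
        · exact mul_le_mul_of_nonneg_left (hf i h) (hw i)
    _ = (∑ i, w i) * c := by rw [Finset.sum_mul]
    _ ≤ c := mul_le_of_le_one_left hc hsum

theorem layer_backward_induction {S : Type*} {H : ℕ} {layer : S → ℕ} (hlayer : ∀ s, layer s ≤ H)
    {p : S → Prop} (step : ∀ s, (∀ s', layer s' = layer s + 1 → p s') → p s) (s : S) : p s := by
  induction hn : H - layer s using Nat.strong_induction_on generalizing s with
  | _ n ih =>
    refine step s fun s' hs' => ih (H - layer s') ?_ s' rfl
    have := hlayer s'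
    omega

theorem abs_value_le {S A : Type*} [Fintype S] [Fintype A] {H : ℕ} {layer : S → ℕ}
    (hlayer : ∀ s, layer s ≤ H) {P : S → A → S → ℝ} (hP_nonneg : ∀ s a s', 0 ≤ P s a s')
    (hP_supp : ∀ s a s', P s a s' ≠ 0 → layer s' = layer s + 1)
    (hP_sum : ∀ s a, layer s < H → ∑ s', P s a s' = 1)
    {σ : ℝ} (hσ : 0 ≤ σ) {l : S → A → ℝ} (hl : ∀ s a, |l s a| ≤ σ)
    {π : S → A → ℝ} (hπ_nonneg : ∀ s a, 0 ≤ π s a) (hπ_sum : ∀ s, ∑ a, π s a = 1)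
    {Q : S → A → ℝ} {V : S → ℝ} (hQ : ∀ s a, Q s a = l s a + ∑ s', P s a s' * V s')
    (hV : ∀ s, V s = ∑ a, π s a * Q s a) (s : S) :
    |V s| ≤ ((H : ℝ) + 1 - layer s) * σ := by
  refine layer_backward_induction hlayer
    (p := fun s => |V s| ≤ ((H : ℝ) + 1 - layer s) * σ) (fun s ih => ?_) s
  have hs : (layer s : ℝ) ≤ H := by exact_mod_cast hlayer s
  have hc : 0 ≤ ((H : ℝ) - layer s) * σ := mul_nonneg (by linarith) hσ
  rw [hV]
  refine abs_sum_mul_le_of_sum_le_one (hπ_nonneg s) (hπ_sum s).le (by linarith) fun a _ => ?_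
  have hsum : ∑ s', P s a s' ≤ 1 := by
    rcases lt_or_ge (layer s) H with h | h
    · exact (hP_sum s a h).le
    · rw [Finset.sum_eq_zero fun s' _ => ?_]
      · exact zero_le_one
      · by_contra h0
        have := hP_supp s a s' h0
        have := hlayer s'
        omega
  have hnext : |∑ s', P s a s' * V s'| ≤ ((H : ℝ) - layer s) * σ := by
    refine abs_sum_mul_le_of_sum_le_one (hP_nonneg s a) hsum hc fun s' h0 => ?_
    have hs' := hP_supp s a s' h0
    refine (ih s' hs').trans_eq ?_
    rw [hs']
    push_cast
    ring
  rw [hQ]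
  have := abs_add_le (l s a) (∑ s', P s a s' * V s')
  linarith [hl s a]

theorem stmt_18
    {S A : Type*} [Fintype S] [Fintype A] [Nonempty S] [Nonempty A]
    [DecidableEq S] [DecidableEq A]
    (H : ℕ) (hH : 1 ≤ H)
    (layer : S → ℕ)
    (hlayer : ∀ s : S, 1 ≤ layer s ∧ layer s ≤ H)
    (hlayer_ne : ∀ h : ℕ, 1 ≤ h → h ≤ H → ∃ s : S, layer s = h)
    (s1 : S) (hs1 : ∀ s : S, (layer s = 1 ↔ s = s1))
    (P : S → A → S → ℝ)
    (hP_nonneg : ∀ s a s', 0 ≤ P s a s')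
    (hP_supp : ∀ s a s', P s a s' ≠ 0 → layer s' = layer s + 1)
    (hP_sum : ∀ s a, layer s < H → ∑ s', P s a s' = 1)
    (Phat : S → A → S → ℝ)
    (hPhat_nonneg : ∀ s a s', 0 ≤ Phat s a s')
    (hPhat_supp : ∀ s a s', Phat s a s' ≠ 0 → layer s' = layer s + 1)
    (hPhat_sum : ∀ s a, layer s < H → ∑ s', Phat s a s' = 1)
    (B : S → A → S → ℝ)
    (hB_nonneg : ∀ s a s', 0 ≤ B s a s')
    (hB : ∀ s a s', layer s' = layer s + 1 → |Phat s a s' - P s a s'| ≤ B s a s')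
    (σ : ℝ) (hσ : 0 < σ)
    (ℓbar : S → A → ℝ) (hℓbar : ∀ s a, |ℓbar s a| ≤ σ)
    (π : S → A → ℝ)
    (hπ_nonneg : ∀ s a, 0 ≤ π s a)
    (hπ_sum : ∀ s, ∑ a, π s a = 1)
    (QP : S → A → ℝ) (VP : S → ℝ)
    (hQP : ∀ s a, QP s a = ℓbar s a + ∑ s', P s a s' * VP s')
    (hVP : ∀ s, VP s = ∑ a, π s a * QP s a)
    (Qh : S → A → ℝ) (Vh : S → ℝ)
    (hQh : ∀ s a, Qh s a =
      (ℓbar s a - (H : ℝ) * σ *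
        ∑ s' ∈ Finset.univ.filter (fun s' : S => layer s' = layer s + 1), B s a s') +
      ∑ s', Phat s a s' * Vh s')
    (hVh : ∀ s, Vh s = ∑ a, π s a * Qh s a) :
    ∀ s, Vh s ≤ VP s := by
  have hbound : ∀ s, |VP s| ≤ (H : ℝ) * σ := fun s => by
    have h1 : (1 : ℝ) ≤ layer s := by exact_mod_cast (hlayer s).1
    refine (abs_value_le (fun s => (hlayer s).2) hP_nonneg hP_supp hP_sum hσ.le hℓbar hπ_nonneg
      hπ_sum hQP hVP s).trans (mul_le_mul_of_nonneg_right (by linarith) hσ.le)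
  refine layer_backward_induction (fun s => (hlayer s).2) fun s ih => ?_
  rw [hVh, hVP]
  refine Finset.sum_le_sum fun a _ => mul_le_mul_of_nonneg_left ?_ (hπ_nonneg s a)
  have hsum : ∑ s', Phat s a s' * Vh s' ≤ ∑ s', P s a s' * VP s' +
      (H : ℝ) * σ * ∑ s' ∈ Finset.univ.filter (fun s' : S => layer s' = layer s + 1), B s a s' := by
    rw [Finset.mul_sum, Finset.sum_filter, ← Finset.sum_add_distrib]
    refine Finset.sum_le_sum fun s' _ => ?_
    split_ifs with hs'
    · have hV := mul_le_mul_of_nonneg_left (ih s' hs') (hPhat_nonneg s a s')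
      have hdiff : (Phat s a s' - P s a s') * VP s' ≤ B s a s' * (H * σ) :=
        (le_abs_self _).trans <| by
          rw [abs_mul]
          exact mul_le_mul (hB s a s' hs') (hbound s') (abs_nonneg _) (hB_nonneg s a s')
      linarith
    · rw [not_imp_comm.1 (hP_supp s a s') hs', not_imp_comm.1 (hPhat_supp s a s') hs']
      simp
  rw [hQh, hQP]
  linarith
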